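/- arXiv:1301.0054 — 2 statements merged into one kernel-verified Lean document; each statement's English description precedes it below -/
import Mathlib

section
/- Let X be a complex Banach space and let T be a bounded linear operator on X such that ‖Tⁿ‖/n → 0 as n → ∞. Then the sequence of Cesàro means M_n(T) = (I + T + … + Tⁿ)/(n+1) converges in operator norm to an element of B(X) if and only if the operator (I − T)² has closed range. -/
open Filter Topology

/-- The Cesàro means `M_n(T) = (I + T + … + Tⁿ)/(n+1)` of an operator `T`. -/
noncomputable def cesaroMean {X : Type*} [NormedAddCommGroup X]
    [NormedSpace ℂ X] (T : X →L[ℂ] X) (n : ℕ) : X →L[ℂ] X :=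
  ((n : ℂ) + 1)⁻¹ • ∑ k ∈ Finset.range (n + 1), T ^ k

section CesaroMean

variable {X : Type*} [NormedAddCommGroup X] [NormedSpace ℂ X]

theorem cesaroMean_mul_one_sub (T : X →L[ℂ] X) (n : ℕ) :
    cesaroMean T n * (1 - T) = ((n : ℂ) + 1)⁻¹ • (1 - T ^ (n + 1)) := by
  rw [cesaroMean, smul_mul_assoc, geom_sum_mul_neg]

theorem commute_cesaroMean {T S : X →L[ℂ] X} (h : Commute T S) (n : ℕ) :
    Commute (cesaroMean T n) S :=
  (Commute.sum_left _ _ _ fun k _ => h.pow_left k).smul_left _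

theorem cesaroMean_comp_of_intertwine {Y : Type*} [NormedAddCommGroup Y] [NormedSpace ℂ Y]
    {T : X →L[ℂ] X} {S : Y →L[ℂ] Y} {J : Y →L[ℂ] X} (h : ∀ y, T (J y) = J (S y))
    (n : ℕ) (y : Y) : cesaroMean T n (J y) = J (cesaroMean S n y) := by
  have hpow (k : ℕ) : (T ^ k) (J y) = J ((S ^ k) y) := by
    induction k with
    | zero => simp
    | succ k ih => rw [pow_succ', pow_succ', mul_apply_eq_comp, ih, h]; rfl
  simp [cesaroMean, sum_apply, hpow]

theorem cesaroMean_apply_of_fixed {T : X →L[ℂ] X} {x : X} (h : T x = x) (n : ℕ) :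
    cesaroMean T n x = x := by
  have hpow (k : ℕ) : (T ^ k) x = x := by
    induction k with
    | zero => simp
    | succ k ih => rw [pow_succ', mul_apply_eq_comp, ih, h]
  have hn : (n : ℂ) + 1 ≠ 0 := Nat.cast_add_one_ne_zero n
  rw [cesaroMean, smul_apply, sum_apply,
    Finset.sum_congr rfl fun k _ => hpow k, Finset.sum_const, Finset.card_range,
    ← Nat.cast_smul_eq_nsmul ℂ, smul_smul]
  push_cast
  rw [inv_mul_cancel₀ hn, one_smul]

theorem exists_one_sub_cesaroMean_eq (T : X →L[ℂ] X) (n : ℕ) :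
    ∃ Q : X →L[ℂ] X, Commute T Q ∧ 1 - cesaroMean T n = (1 - T) * Q := by
  refine ⟨((n : ℂ) + 1)⁻¹ • ∑ k ∈ Finset.range (n + 1), ∑ j ∈ Finset.range k, T ^ j,
    (Commute.sum_right _ _ _ fun k _ => Commute.sum_right _ _ _ fun j _ =>
      (Commute.refl T).pow_right j).smul_right _, ?_⟩
  have hn : (n : ℂ) + 1 ≠ 0 := Nat.cast_add_one_ne_zero n
  rw [mul_smul_comm, Finset.mul_sum, Finset.sum_congr rfl fun k _ => mul_neg_geom_sum T k,
    Finset.sum_sub_distrib, smul_sub, Finset.sum_const, Finset.card_range,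
    ← Nat.cast_smul_eq_nsmul ℂ, smul_smul]
  push_cast
  rw [inv_mul_cancel₀ hn, one_smul, cesaroMean]

theorem tendsto_cesaroMean_mul_one_sub {T : X →L[ℂ] X}
    (hT : Tendsto (fun n : ℕ => ‖T ^ n‖ / n) atTop (𝓝 0)) :
    Tendsto (fun n : ℕ => cesaroMean T n * (1 - T)) atTop (𝓝 0) := by
  have h1 : Tendsto (fun n : ℕ => ‖(1 : X →L[ℂ] X)‖ / ((n + 1 : ℕ) : ℝ)
      + ‖T ^ (n + 1)‖ / ((n + 1 : ℕ) : ℝ)) atTop (𝓝 (0 + 0)) :=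
    ((tendsto_const_div_atTop_nhds_zero_nat _).comp (tendsto_add_atTop_nat 1)).add
      (hT.comp (tendsto_add_atTop_nat 1))
  rw [add_zero] at h1
  refine squeeze_zero_norm (fun n => ?_) h1
  have hn : ‖(n : ℂ) + 1‖ = ((n + 1 : ℕ) : ℝ) := by
    rw [← Nat.cast_succ, Complex.norm_natCast]
  rw [cesaroMean_mul_one_sub, norm_smul, norm_inv, hn, ← add_div, div_eq_inv_mul]
  gcongr
  exact norm_sub_le _ _

variable [CompleteSpace X]

theorem isClosed_range_one_sub_sq_of_tendsto_cesaroMean {T P : X →L[ℂ] X}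
    (hT : Tendsto (fun n : ℕ => ‖T ^ n‖ / n) atTop (𝓝 0))
    (hP : Tendsto (fun n : ℕ => cesaroMean T n) atTop (𝓝 P)) :
    IsClosed (Set.range ((1 - T) ^ 2 : X →L[ℂ] X)) := by
  have hPA : P * (1 - T) = 0 :=
    tendsto_nhds_unique (hP.mul_const _) (tendsto_cesaroMean_mul_one_sub hT)
  have hcomm {S : X →L[ℂ] X} (hS : Commute T S) : Commute P S :=
    tendsto_nhds_unique (hP.mul_const S)
      ((hP.const_mul S).congr fun n => (commute_cesaroMean hS n).eq.symm)
  have hTP : Commute T P := (hcomm (Commute.refl T)).symm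
  have hAP : (1 - T) * P = 0 := by
    rw [((Commute.one_left P).sub_left hTP).eq, hPA]
  have hfix (x : X) : T (P x) = P x := by
    have h : P x - T (P x) = 0 := DFunLike.congr_fun hAP x
    exact (sub_eq_zero.1 h).symm
  have hPP : P * P = P :=
    tendsto_nhds_unique (hP.mul_const P) (tendsto_const_nhds.congr fun n =>
      ContinuousLinearMap.ext fun x => (cesaroMean_apply_of_fixed (hfix x) n).symm)
  obtain ⟨n, hn⟩ := (Metric.tendsto_atTop.1 hP 1 one_pos).imp fun N h => h N le_rfl
  rw [dist_eq_norm] at hn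
  obtain ⟨Q, hTQ, hQ⟩ := exists_one_sub_cesaroMean_eq T n
  have hPQ := hcomm hTQ
  have hfac : (1 - T + P) * (Q * (1 - P) + P) = 1 - (cesaroMean T n - P) := by
    have e : 1 - (cesaroMean T n - P) = (1 - T) * Q + P := by rw [← hQ]; abel
    calc (1 - T + P) * (Q * (1 - P) + P)
        = (1 - T) * Q - (1 - T) * (Q * P) + (1 - T) * P + (P * Q - P * (Q * P) + P * P) := by
          noncomm_ring
      _ = 1 - (cesaroMean T n - P) := by
          rw [e, ← hPQ.eq, ← mul_assoc, ← mul_assoc, hAP, hPP]; simp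
  have hunit : IsUnit (1 - T + P) := by
    have hc : Commute (1 - T + P) (Q * (1 - P) + P) := by
      have hTX : Commute T (Q * (1 - P) + P) :=
        (hTQ.mul_right ((Commute.one_right T).sub_right hTP)).add_right hTP
      exact ((Commute.one_left _).sub_left hTX).add_left (hcomm hTX)
    refine (hc.isUnit_mul_iff.1 ?_).1
    rw [hfac]
    exact isUnit_one_sub_of_norm_lt_one hn
  have hsq : (1 - T) ^ 2 = (1 - P) * (1 - T + P) ^ 2 := by
    have h1 : (1 - P) * (1 - T + P) = 1 - T := by
      rw [sub_mul, one_mul, mul_add, hPA, hPP]; abel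
    have h2 : (1 - T) * (1 - T + P) = (1 - T) ^ 2 := by rw [mul_add, hAP, add_zero, sq]
    rw [sq (1 - T + P), ← mul_assoc, h1, h2]
  obtain ⟨U, hU⟩ := hunit.pow 2
  have hrange : Set.range ((1 - T) ^ 2 : X →L[ℂ] X) = {x | P x = 0} := by
    ext y
    constructor
    · rintro ⟨x, rfl⟩
      change (P * (1 - T) ^ 2 : X →L[ℂ] X) x = 0
      rw [sq, ← mul_assoc, hPA]
      simp
    · intro hy
      refine ⟨(↑U⁻¹ : X →L[ℂ] X) y, ?_⟩
      rw [hsq, ← hU, ← mul_apply_eq_comp, mul_assoc, Units.mul_inv, mul_one]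
      simpa using hy
  rw [hrange]
  exact isClosed_eq P.continuous continuous_const

theorem exists_tendsto_cesaroMean_of_isClosed_range {T : X →L[ℂ] X}
    (hT : Tendsto (fun n : ℕ => ‖T ^ n‖ / n) atTop (𝓝 0))
    (hA : IsClosed (Set.range ((1 - T) ^ 2 : X →L[ℂ] X))) :
    ∃ P : X →L[ℂ] X, Tendsto (fun n : ℕ => cesaroMean T n) atTop (𝓝 P) := by
  have hMA := tendsto_cesaroMean_mul_one_sub hT
  let Y : Submodule ℂ X := LinearMap.range ((1 - T) ^ 2 : X →L[ℂ] X).toLinearMap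
  have : CompleteSpace Y := hA.isComplete.completeSpace_coe
  have hTY (y : Y) : (T ∘L Y.subtypeL) y ∈ Y := by
    obtain ⟨x, hx⟩ := y.2
    refine ⟨T x, ?_⟩
    have hc : Commute ((1 - T) ^ 2) T :=
      ((Commute.one_left T).sub_left (Commute.refl T)).pow_left 2
    have hx' : ((1 - T) ^ 2 : X →L[ℂ] X) x = (y : X) := hx
    change ((1 - T) ^ 2 * T : X →L[ℂ] X) x = T y
    rw [hc.eq, mul_apply_eq_comp, hx']
  let S : Y →L[ℂ] Y := (T ∘L Y.subtypeL).codRestrict Y hTY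
  let F : X →L[ℂ] Y := ((1 - T) ^ 2).codRestrict Y fun x => ⟨x, rfl⟩
  have hF (x : X) : (F x : X) = (1 - T) ((1 - T) x) := by
    change ((1 - T) ^ 2 : X →L[ℂ] X) x = _
    rw [sq]; rfl
  have hS (y : Y) : (((1 - S) y : Y) : X) = (1 - T) y := rfl
  have hFsurj : Function.Surjective F := by
    rintro ⟨_, x, rfl⟩
    exact ⟨x, rfl⟩
  obtain ⟨C, hC, hFC⟩ := F.exists_preimage_norm_le hFsurj
  have hbound (n : ℕ) : ‖cesaroMean S n‖ ≤ ‖cesaroMean T n * (1 - T)‖ * (‖1 - T‖ * C) := by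
    refine ContinuousLinearMap.opNorm_le_bound _ (by positivity) fun y => ?_
    obtain ⟨x, rfl, hx⟩ := hFC y
    have h1 : ((cesaroMean S n (F x) : Y) : X) = (cesaroMean T n * (1 - T)) ((1 - T) x) := by
      rw [mul_apply_eq_comp, ← hF]
      exact (cesaroMean_comp_of_intertwine (J := Y.subtypeL) (S := S) (fun _ => rfl) n _).symm
    rw [← Submodule.norm_coe (cesaroMean S n (F x)), h1, mul_assoc, mul_assoc]
    refine (ContinuousLinearMap.le_opNorm _ _).trans ?_
    gcongr
    refine (ContinuousLinearMap.le_opNorm _ _).trans ?_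
    gcongr
  have hlim : Tendsto (fun n => ‖cesaroMean T n * (1 - T)‖ * (‖1 - T‖ * C)) atTop (𝓝 0) := by
    simpa using hMA.norm.mul_const (‖1 - T‖ * C)
  obtain ⟨n, hn⟩ := (hlim.eventually_lt_const one_pos).exists
  have hunit : IsUnit (1 - S) := by
    obtain ⟨Q, hSQ, hQ⟩ := exists_one_sub_cesaroMean_eq S n
    refine (((Commute.one_left Q).sub_left hSQ).isUnit_mul_iff.1 ?_).1
    rw [← hQ]
    exact isUnit_one_sub_of_norm_lt_one ((hbound n).trans_lt hn)
  obtain ⟨U, hU⟩ := hunit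
  let V : Y →L[ℂ] Y := ↑U⁻¹
  have hV (y : Y) : (1 - T) (V y : X) = y := by
    rw [← hS, ← hU]
    exact congrArg Subtype.val (DFunLike.congr_fun U.mul_inv y)
  let W : X →L[ℂ] X := Y.subtypeL ∘L (V * V * V) ∘L F
  have hW (x : X) : (1 - T) ((1 - T) ((1 - T) (W x))) = (1 - T) ((1 - T) x) := by
    change (1 - T) ((1 - T) ((1 - T) (V (V (V (F x))) : X))) = _
    rw [hV, hV, hV, hF]
  have hker {x : X} (hx : (1 - T) ((1 - T) x) = 0) : (1 - T) x = 0 := by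
    have hfix : T ((1 - T) x) = (1 - T) x := by
      rw [sub_apply, sub_eq_zero] at hx
      exact hx.symm
    have h0 : Tendsto (fun n => (cesaroMean T n * (1 - T)) x) atTop (𝓝 ((0 : X →L[ℂ] X) x)) :=
      ((ContinuousLinearMap.apply ℂ X x).continuous.tendsto _).comp hMA
    exact tendsto_nhds_unique
      (tendsto_const_nhds.congr fun n => (cesaroMean_apply_of_fixed hfix n).symm) h0
  have hfix (x : X) : T (x - (1 - T) (W x)) = x - (1 - T) (W x) := by
    have h := hker (x := x - (1 - T) (W x)) (by
      rw [map_sub, map_sub, hW, sub_self])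
    rw [sub_apply, sub_eq_zero] at h
    exact h.symm
  refine ⟨1 - (1 - T) * W, ?_⟩
  have hdecomp (n : ℕ) :
      cesaroMean T n * (1 - T) * W + (1 - (1 - T) * W) = cesaroMean T n := by
    have h : cesaroMean T n * (1 - (1 - T) * W) = 1 - (1 - T) * W :=
      ContinuousLinearMap.ext fun x => cesaroMean_apply_of_fixed (hfix x) n
    rw [mul_sub, mul_one, ← mul_assoc] at h
    rw [← h]; abel
  simpa using ((hMA.mul_const W).add_const (1 - (1 - T) * W)).congr hdecomp

end CesaroMean

/-- For `T` on a complex Banach space with `‖Tⁿ‖/n → 0`, the Cesàro means of `T`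
converge in operator norm iff `(I - T)²` has closed range. -/
theorem cesaro_converges_iff_closed_range_sq
    {X : Type*} [NormedAddCommGroup X] [NormedSpace ℂ X] [CompleteSpace X]
    (T : X →L[ℂ] X)
    (hT : Tendsto (fun n : ℕ => ‖T ^ n‖ / n) atTop (𝓝 0)) :
    (∃ P : X →L[ℂ] X, Tendsto (fun n : ℕ => cesaroMean T n) atTop (𝓝 P)) ↔
      IsClosed (Set.range ((1 - T) ^ 2 : X →L[ℂ] X)) :=
  ⟨fun ⟨_, hP⟩ => isClosed_range_one_sub_sq_of_tendsto_cesaroMean hT hP,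
    exists_tendsto_cesaroMean_of_isClosed_range hT⟩
end

section
/- Let X be a complex Banach space and let T be a bounded linear operator on X such that ‖Tⁿ‖/n → 0 as n → ∞. Then the sequence of Cesàro means M_n(T) = (I + T + … + Tⁿ)/(n+1) converges in operator norm to an element of B(X) if and only if either 1 lies in the resolvent set of T, or 1 is a simple pole of the resolvent of T (i.e., the resolvent function z ↦ (z·I − T)⁻¹ is meromorphic at 1 with a pole of order exactly 1). -/
open Filter Topology

/-- `1` is a simple pole of the resolvent of `T`: the resolvent is defined on a punctured
neighborhood of `1`, and `(z - 1) • (z • I - T)⁻¹` tends to a nonzero limit as `z → 1`. -/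
def IsSimplePoleOfResolventAtOne {X : Type*} [NormedAddCommGroup X]
    [NormedSpace ℂ X] (T : X →L[ℂ] X) : Prop :=
  (∀ᶠ z in 𝓝[≠] (1 : ℂ), z ∈ resolventSet ℂ T) ∧
    ∃ L : X →L[ℂ] X, L ≠ 0 ∧
      Tendsto (fun z : ℂ => (z - 1) • resolvent T z) (𝓝[≠] (1 : ℂ)) (𝓝 L)

/-- The Cesàro mean telescopes against `1 - T`. -/
theorem one_sub_mul_cesaroMean {X : Type*} [NormedAddCommGroup X] [NormedSpace ℂ X]
    (T : X →L[ℂ] X) (n : ℕ) :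
    (1 - T) * cesaroMean T n = ((n : ℂ) + 1)⁻¹ • (1 - T ^ (n + 1)) := by
  rw [cesaroMean, mul_smul_comm, mul_neg_geom_sum]

theorem Commute.cesaroMean_left {X : Type*} [NormedAddCommGroup X] [NormedSpace ℂ X]
    {T S : X →L[ℂ] X} (h : Commute T S) (n : ℕ) : Commute (cesaroMean T n) S :=
  (Commute.sum_left _ _ _ fun k _ => h.pow_left k).smul_left _

theorem cesaroMean_mul_of_mul_eq {X : Type*} [NormedAddCommGroup X] [NormedSpace ℂ X]
    {T P : X →L[ℂ] X} (h : T * P = P) (n : ℕ) : cesaroMean T n * P = P := by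
  have hpow (k : ℕ) : T ^ k * P = P := by
    induction k with
    | zero => simp
    | succ k ih => rw [pow_succ, mul_assoc, h, ih]
  have hn : (n : ℂ) + 1 ≠ 0 := by exact_mod_cast n.succ_ne_zero
  rw [cesaroMean, smul_mul_assoc, Finset.sum_mul, Finset.sum_congr rfl fun k _ => hpow k,
    Finset.sum_const, Finset.card_range, ← Nat.cast_smul_eq_nsmul ℂ, Nat.cast_succ, smul_smul,
    inv_mul_cancel₀ hn, one_smul]

/-- `1 - cesaroMean T n` factors through `1 - T`, with a cofactor that is a polynomial in `T`. -/
theorem exists_one_sub_cesaroMean_eq_mul {X : Type*} [NormedAddCommGroup X] [NormedSpace ℂ X]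
    (T : X →L[ℂ] X) (n : ℕ) :
    ∃ Q : X →L[ℂ] X, 1 - cesaroMean T n = (1 - T) * Q ∧ ∀ S, Commute T S → Commute Q S := by
  refine ⟨((n : ℂ) + 1)⁻¹ • ∑ k ∈ Finset.range (n + 1), ∑ i ∈ Finset.range k, T ^ i, ?_,
    fun S h => (Commute.sum_left _ _ _ fun k _ =>
      Commute.sum_left _ _ _ fun i _ => h.pow_left i).smul_left _⟩
  have hn : (n : ℂ) + 1 ≠ 0 := by exact_mod_cast n.succ_ne_zero
  rw [mul_smul_comm, Finset.mul_sum, Finset.sum_congr rfl fun k _ => mul_neg_geom_sum T k,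
    Finset.sum_sub_distrib, smul_sub, Finset.sum_const, Finset.card_range,
    ← Nat.cast_smul_eq_nsmul ℂ, Nat.cast_succ, smul_smul, inv_mul_cancel₀ hn, one_smul, cesaroMean]

theorem tendsto_one_sub_mul_cesaroMean {X : Type*} [NormedAddCommGroup X] [NormedSpace ℂ X]
    {T : X →L[ℂ] X} (hT : Tendsto (fun n : ℕ => ‖T ^ n‖ / n) atTop (𝓝 0)) :
    Tendsto (fun n : ℕ => (1 - T) * cesaroMean T n) atTop (𝓝 0) := by
  have hone : Tendsto (fun n : ℕ => ((n : ℂ) + 1)⁻¹ • (1 : X →L[ℂ] X)) atTop (𝓝 0) := by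
    have h := (tendsto_one_div_add_atTop_nhds_zero_nat (𝕜 := ℂ)).smul_const (1 : X →L[ℂ] X)
    simpa only [one_div, zero_smul] using h
  have hpow : Tendsto (fun n : ℕ => ((n : ℂ) + 1)⁻¹ • T ^ (n + 1)) atTop (𝓝 0) := by
    rw [tendsto_zero_iff_norm_tendsto_zero]
    refine ((tendsto_add_atTop_iff_nat 1).2 hT).congr fun n => ?_
    rw [norm_smul, norm_inv, ← Nat.cast_succ, Complex.norm_natCast, div_eq_inv_mul]
  simpa only [one_sub_mul_cesaroMean, smul_sub, sub_zero] using hone.sub hpow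

theorem mul_eq_of_tendsto_cesaroMean {X : Type*} [NormedAddCommGroup X] [NormedSpace ℂ X]
    {T P : X →L[ℂ] X} (hT : Tendsto (fun n : ℕ => ‖T ^ n‖ / n) atTop (𝓝 0))
    (hP : Tendsto (fun n : ℕ => cesaroMean T n) atTop (𝓝 P)) :
    T * P = P ∧ Commute T P ∧ P * P = P := by
  have h₁ : (1 - T) * P = 0 :=
    tendsto_nhds_unique (hP.const_mul (1 - T)) (tendsto_one_sub_mul_cesaroMean hT)
  have hTP : T * P = P := by
    rw [sub_mul, one_mul, sub_eq_zero] at h₁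
    exact h₁.symm
  refine ⟨hTP, ?_, ?_⟩
  · refine tendsto_nhds_unique (hP.const_mul T) ((hP.mul_const T).congr fun n => ?_)
    exact (Commute.refl T).cesaroMean_left n
  · refine tendsto_nhds_unique (hP.mul_const P) ?_
    simp only [cesaroMean_mul_of_mul_eq hTP, tendsto_const_nhds]

theorem isUnit_one_sub_add_of_tendsto_cesaroMean {X : Type*} [NormedAddCommGroup X]
    [NormedSpace ℂ X] [CompleteSpace X] {T P : X →L[ℂ] X}
    (hT : Tendsto (fun n : ℕ => ‖T ^ n‖ / n) atTop (𝓝 0))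
    (hP : Tendsto (fun n : ℕ => cesaroMean T n) atTop (𝓝 P)) : IsUnit (1 - T + P) := by
  obtain ⟨hTP, hcomm, hPP⟩ := mul_eq_of_tendsto_cesaroMean hT hP
  obtain ⟨n, hn⟩ := (Metric.tendsto_nhds.1 hP 1 one_pos).exists
  rw [dist_eq_norm] at hn
  obtain ⟨Q, hQ, hQcomm⟩ := exists_one_sub_cesaroMean_eq_mul T n
  have hQP : Q * P = P * Q := hQcomm P hcomm
  have hQT : Q * T = T * Q := hQcomm T (Commute.refl T)
  have hPT : P * T = P := hcomm.eq.symm.trans hTP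
  have hunit : IsUnit ((1 - T + P) * (Q * (1 - P) + P)) := by
    convert isUnit_one_sub_of_norm_lt_one hn using 1
    rw [← sub_add, hQ]
    have hTQP : T * (Q * P) = Q * P := by rw [hQP, ← mul_assoc, hTP]
    have hPQP : P * (Q * P) = P * Q := by rw [hQP, ← mul_assoc, hPP]
    simp only [mul_add, add_mul, mul_sub, sub_mul, mul_one, one_mul, hTQP, hPQP, hTP, hPP]
    abel
  have hc : Commute (1 - T + P) (Q * (1 - P) + P) := by
    have hQ' : Commute (1 - T + P) Q :=
      (((Commute.one_left Q).sub_left (Commute.symm hQT)).add_left (Commute.symm hQP))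
    have hP' : Commute (1 - T + P) P :=
      ((Commute.one_left P).sub_left hcomm).add_left (Commute.refl P)
    exact (hQ'.mul_right ((Commute.one_right _).sub_right hP')).add_right hP'
  exact (hc.isUnit_mul_iff.1 hunit).1

/-- If `P` is a projection with `T P = P T = P`, then the resolvent of `T` at `z` splits into
`P / (z - 1)` and the inverse of `z - T + P` on the range of `1 - P`. -/
theorem resolvent_eq_of_isUnit {A : Type*} [Ring A] [Algebra ℂ A] {T P : A} (hTP : T * P = P)
    (hPT : P * T = P) (hPP : P * P = P) {z : ℂ} (hz : z ≠ 1)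
    (hu : IsUnit (algebraMap ℂ A z - T + P)) :
    z ∈ resolventSet ℂ T ∧
      resolvent T z = Ring.inverse (algebraMap ℂ A z - T + P) * (1 - P) + (z - 1)⁻¹ • P := by
  have hz' : z - 1 ≠ 0 := sub_ne_zero.2 hz
  set V := Ring.inverse (algebraMap ℂ A z - T + P) with hV
  have hzP : (algebraMap ℂ A z - T) * P = (z - 1) • P := by
    rw [sub_mul, hTP, ← Algebra.smul_def, sub_smul, one_smul]
  have hPz : P * (algebraMap ℂ A z - T) = (z - 1) • P := by
    rw [mul_sub, hPT, ← Algebra.commutes, ← Algebra.smul_def, sub_smul, one_smul]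
  have hcomm : Commute (algebraMap ℂ A z - T + P) (1 - P) :=
    (Commute.one_right _).sub_right
      (Commute.add_left (hzP.trans hPz.symm) (Commute.refl P))
  have hVcomm : V * (1 - P) = (1 - P) * V := by
    rw [hV, ← Ring.mul_inverse_cancel_right _ (V * (1 - P)) hu, mul_assoc V, ← hcomm.eq,
      Ring.inverse_mul_cancel_left _ _ hu]
  have hsplit : (algebraMap ℂ A z - T + P) * (1 - P) = (algebraMap ℂ A z - T) * (1 - P) := by
    rw [add_mul, mul_sub P, mul_one, hPP, sub_self, add_zero]
  have hsplit' : (1 - P) * (algebraMap ℂ A z - T + P) = (1 - P) * (algebraMap ℂ A z - T) := by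
    rw [mul_add, sub_mul 1 P P, one_mul, hPP, sub_self, add_zero]
  have hr : (algebraMap ℂ A z - T) * (V * (1 - P) + (z - 1)⁻¹ • P) = 1 := by
    rw [mul_add, hVcomm, ← mul_assoc, ← hsplit, hcomm.eq, mul_assoc,
      Ring.mul_inverse_cancel _ hu, mul_one, mul_smul_comm, hzP, inv_smul_smul₀ hz',
      sub_add_cancel]
  have hl : (V * (1 - P) + (z - 1)⁻¹ • P) * (algebraMap ℂ A z - T) = 1 := by
    rw [add_mul, mul_assoc, ← hsplit', ← hcomm.eq, ← mul_assoc,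
      Ring.inverse_mul_cancel _ hu, one_mul, smul_mul_assoc, hPz, inv_smul_smul₀ hz',
      sub_add_cancel]
  exact ⟨spectrum.mem_resolventSet_of_left_right_inverse hr hl,
    Ring.inverse_unit (⟨_, _, hr, hl⟩ : Aˣ)⟩

/-- If `P` is a projection with `T P = P T = P` and `1 - T + P` is invertible, then near `1` the
resolvent of `T` has at most a simple pole, with residue `P`. -/
theorem tendsto_sub_smul_resolvent {A : Type*} [NormedRing A] [NormedAlgebra ℂ A] [CompleteSpace A]
    {T P : A} (hTP : T * P = P) (hPT : P * T = P) (hPP : P * P = P) (hu : IsUnit (1 - T + P)) :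
    (∀ᶠ z in 𝓝[≠] (1 : ℂ), z ∈ resolventSet ℂ T) ∧
      Tendsto (fun z : ℂ => (z - 1) • resolvent T z) (𝓝[≠] (1 : ℂ)) (𝓝 P) := by
  have hcont : Tendsto (fun z : ℂ => algebraMap ℂ A z - T + P) (𝓝[≠] 1) (𝓝 (1 - T + P)) := by
    have h : Continuous fun z : ℂ => algebraMap ℂ A z - T + P := by fun_prop
    simpa using (h.tendsto 1).mono_left nhdsWithin_le_nhds
  have hev : ∀ᶠ z in 𝓝[≠] (1 : ℂ), z ≠ 1 ∧ IsUnit (algebraMap ℂ A z - T + P) :=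
    eventually_mem_nhdsWithin.and (hcont.eventually (Units.isOpen.mem_nhds hu))
  refine ⟨hev.mono fun z hz => (resolvent_eq_of_isUnit hTP hPT hPP hz.1 hz.2).1, ?_⟩
  have hinv := (NormedRing.inverse_continuousAt hu.unit).tendsto.comp hcont
  have hsub : Tendsto (fun z : ℂ => z - 1) (𝓝[≠] 1) (𝓝 0) := by
    have h : Continuous fun z : ℂ => z - 1 := by fun_prop
    simpa using (h.tendsto 1).mono_left nhdsWithin_le_nhds
  have hlim := (hsub.smul (hinv.mul_const (1 - P))).add_const P
  rw [zero_smul, zero_add] at hlim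
  refine hlim.congr' (hev.mono fun z hz => ?_)
  dsimp only
  rw [(resolvent_eq_of_isUnit hTP hPT hPP hz.1 hz.2).2, smul_add,
    smul_inv_smul₀ (sub_ne_zero.2 hz.1), Function.comp_apply]

/-- A limit `L` of `(z - 1) • resolvent T z` at `1` is a projection onto the kernel of `1 - T`,
and `1 - L` factors through `1 - T`. -/
theorem exists_one_sub_eq_mul_of_tendsto_resolvent {A : Type*} [NormedRing A] [NormedAlgebra ℂ A]
    [CompleteSpace A] {T L : A} (hres : ∀ᶠ z in 𝓝[≠] (1 : ℂ), z ∈ resolventSet ℂ T)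
    (hL : Tendsto (fun z : ℂ => (z - 1) • resolvent T z) (𝓝[≠] (1 : ℂ)) (𝓝 L)) :
    T * L = L ∧ ∃ B, 1 - L = (1 - T) * B := by
  have hsub : Tendsto (fun z : ℂ => z - 1) (𝓝[≠] 1) (𝓝 0) := by
    have h : Continuous fun z : ℂ => z - 1 := by fun_prop
    simpa using (h.tendsto 1).mono_left nhdsWithin_le_nhds
  have hcont : Tendsto (fun z : ℂ => algebraMap ℂ A z - T) (𝓝[≠] 1) (𝓝 (1 - T)) := by
    have h : Continuous fun z : ℂ => algebraMap ℂ A z - T := by fun_prop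
    simpa using (h.tendsto 1).mono_left nhdsWithin_le_nhds
  have hzero : Tendsto (fun z : ℂ => (z - 1) • (1 : A)) (𝓝[≠] 1) (𝓝 0) := by
    simpa using hsub.smul_const (1 : A)
  have hleft : (1 - T) * L = 0 := by
    refine tendsto_nhds_unique (hcont.mul hL) (hzero.congr' (hres.mono fun z hz => ?_))
    dsimp only
    rw [mul_smul_comm, resolvent, Ring.mul_inverse_cancel _ hz]
  have hright : L * (1 - T) = 0 := by
    refine tendsto_nhds_unique (hL.mul hcont) (hzero.congr' (hres.mono fun z hz => ?_))
    dsimp only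
    rw [smul_mul_assoc, resolvent, Ring.inverse_mul_cancel _ hz]
  have hTL : T * L = L := by
    rw [sub_mul, one_mul, sub_eq_zero] at hleft
    exact hleft.symm
  have hzL (z : ℂ) : (algebraMap ℂ A z - T) * L = (z - 1) • L := by
    rw [sub_mul, hTL, ← Algebra.smul_def, sub_smul, one_smul]
  have hLL : L * L = L := by
    refine tendsto_nhds_unique (hL.mul_const L)
      (tendsto_const_nhds.congr' (hres.mono fun z hz => ?_))
    dsimp only
    rw [smul_mul_assoc, ← mul_smul_comm, ← hzL z, ← mul_assoc, resolvent,
      Ring.inverse_mul_cancel _ hz, one_mul]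
  obtain ⟨z, hz, hnear⟩ := (hres.and (Metric.tendsto_nhds.1 hL 1 one_pos)).exists
  rw [dist_eq_norm] at hnear
  have hW : IsUnit (1 - T + (z - 1) • L) := by
    convert (show IsUnit (algebraMap ℂ A z - T) from hz).mul (isUnit_one_sub_of_norm_lt_one hnear)
      using 1
    rw [mul_sub, mul_sub, hzL, mul_one, mul_smul_comm, resolvent, Ring.mul_inverse_cancel _ hz,
      sub_smul z, Algebra.algebraMap_eq_smul_one, sub_smul, one_smul, one_smul]
    abel
  refine ⟨hTL, Ring.inverse (1 - T + (z - 1) • L), ?_⟩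
  have hfactor : (1 - L) * (1 - T + (z - 1) • L) = 1 - T := by
    rw [mul_add, sub_mul, one_mul, hright, sub_zero, mul_smul_comm, sub_mul, one_mul, hLL,
      sub_self, smul_zero, add_zero]
  exact (Ring.eq_mul_inverse_iff_mul_eq _ _ _ hW).2 hfactor

theorem tendsto_cesaroMean_of_one_sub_eq_mul {X : Type*} [NormedAddCommGroup X] [NormedSpace ℂ X]
    {T L B : X →L[ℂ] X} (hT : Tendsto (fun n : ℕ => ‖T ^ n‖ / n) atTop (𝓝 0)) (hTL : T * L = L)
    (hB : 1 - L = (1 - T) * B) : Tendsto (fun n : ℕ => cesaroMean T n) atTop (𝓝 L) := by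
  have h := ((tendsto_one_sub_mul_cesaroMean hT).mul_const B).add_const L
  rw [zero_mul, zero_add] at h
  refine h.congr fun n => ?_
  have hc : Commute (cesaroMean T n) (1 - T) :=
    (Commute.one_right _).sub_right ((Commute.refl T).cesaroMean_left n)
  rw [← hc.eq, mul_assoc, ← hB, mul_sub, mul_one, cesaroMean_mul_of_mul_eq hTL, sub_add_cancel]

/-- **Dunford**: for `T` on a complex Banach space with `‖Tⁿ‖/n → 0`, the Cesàro means
of `T` converge in operator norm iff `1` is in the resolvent set of `T` or `1` is a
simple pole of the resolvent of `T`. -/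
theorem cesaro_converges_iff_simple_pole
    {X : Type*} [NormedAddCommGroup X] [NormedSpace ℂ X] [CompleteSpace X]
    (T : X →L[ℂ] X)
    (hT : Tendsto (fun n : ℕ => ‖T ^ n‖ / n) atTop (𝓝 0)) :
    (∃ P : X →L[ℂ] X, Tendsto (fun n : ℕ => cesaroMean T n) atTop (𝓝 P)) ↔
      ((1 : ℂ) ∈ resolventSet ℂ T ∨ IsSimplePoleOfResolventAtOne T) := by
  constructor
  · rintro ⟨P, hP⟩
    have hu := isUnit_one_sub_add_of_tendsto_cesaroMean hT hP
    obtain ⟨hTP, hcomm, hPP⟩ := mul_eq_of_tendsto_cesaroMean hT hP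
    rcases eq_or_ne P 0 with rfl | hP0
    · left
      rwa [spectrum.mem_resolventSet_iff, map_one, ← add_zero (1 - T)]
    · obtain ⟨hres, hlim⟩ := tendsto_sub_smul_resolvent hTP (hcomm.eq.symm.trans hTP) hPP hu
      exact Or.inr ⟨hres, P, hP0, hlim⟩
  · rintro (h | ⟨hres, L, -, hL⟩)
    · rw [spectrum.mem_resolventSet_iff, map_one] at h
      refine ⟨0, tendsto_cesaroMean_of_one_sub_eq_mul (B := Ring.inverse (1 - T)) hT
        (mul_zero T) ?_⟩
      rw [sub_zero, Ring.mul_inverse_cancel _ h]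
    · obtain ⟨hTL, B, hB⟩ := exists_one_sub_eq_mul_of_tendsto_resolvent hres hL
      exact ⟨L, tendsto_cesaroMean_of_one_sub_eq_mul hT hTL hB⟩
end
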